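/- Let d ∈ ℤ_{>0} and let X = [[z√ε, u√ε],[v√ε, z√ε]] with z, u, v ∈ F, ν(z) ≥ −d and ν(v) > ν(u) = −d. For k ∈ K, the following are equivalent: (i) Ψ_X(k·g·k^{-1}) = Ψ_X(g) for all g ∈ K_{⌊d/2⌋+1}; (ii) k·X·k^{-1} − X ∈ 𝔨_{−d/2}. -/

import Mathlib

open Matrix

noncomputable section

/-- A 2×2 matrix over `E`. -/
abbrev Mat (E : Type) := Matrix (Fin 2) (Fin 2) E

/-- The context: `E/F` is the unramified quadratic extension of a finite extension `F` of
`ℚ_p` (`p` odd), encoded via the Galois involution `sig` (whose fixed field is `F`),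
the valuation `nu` (normalized by `nu ϖ = 1` for a uniformizer `ϖ` of `F`),
a square root `sqeps` of a non-square unit `eps = sqeps^2` of `O_F`, the residue-field
cardinality `q` of `F`, and an additive character `psi'` of `F` trivial on `p_F` and
nontrivial on `O_F`. -/
structure USetting (E : Type) [Field E] where
  sig : E →+* E
  nu : E → WithTop ℤ
  sqeps : E
  pi : E
  q : ℕ
  psi' : E → ℂ
  sig_invol : ∀ x, sig (sig x) = x
  sig_ne : ∃ x, sig x ≠ x
  nu_eq_top : ∀ x, nu x = ⊤ ↔ x = 0
  nu_mul : ∀ x y, nu (x * y) = nu x + nu y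
  nu_add : ∀ x y, min (nu x) (nu y) ≤ nu (x + y)
  nu_sig : ∀ x, nu (sig x) = nu x
  nu_pi : nu pi = 1
  sig_pi : sig pi = pi
  sig_sqeps : sig sqeps = - sqeps
  nu_sqeps : nu sqeps = 0
  eps_not_square : ∀ y, sig y = y → y * y ≠ sqeps * sqeps
  gen : ∀ x : E, ∃ a b, sig a = a ∧ sig b = b ∧ x = a + b * sqeps
  nu_two : nu 2 = 0
  charzero : ∀ n : ℕ, (n : E) = 0 → n = 0
  complete : ∀ f : ℕ → E, (∀ n : ℕ, ((n : ℤ) : WithTop ℤ) ≤ nu (f (n + 1) - f n)) →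
    ∃ L, ∀ n : ℕ, ((n : ℤ) : WithTop ℤ) ≤ nu (L - f n)
  res_card : ∃ R : Finset E, R.card = q ∧ (∀ x ∈ R, sig x = x ∧ 0 ≤ nu x) ∧
    ∀ y : E, sig y = y → 0 ≤ nu y → ∃! x, x ∈ R ∧ 1 ≤ nu (y - x)
  psi'_mul : ∀ x y, sig x = x → sig y = y → psi' (x + y) = psi' x * psi' y
  psi'_ne : ∀ x, sig x = x → psi' x ≠ 0
  psi'_triv : ∀ x, sig x = x → 1 ≤ nu x → psi' x = 1
  psi'_nontriv : ∃ x, sig x = x ∧ 0 ≤ nu x ∧ psi' x ≠ 1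

variable {E : Type} [Field E]

/-- The matrix `w₀ = [[0,1],[1,0]]`. -/
def w0 (E : Type) [Field E] : Mat E := !![0, 1; 1, 0]

/-- `G = U(1,1)(F)`. -/
def Gset (S : USetting E) : Set (Mat E) :=
  {g | (g.map ⇑S.sig)ᵀ * w0 E * g = w0 E}

/-- `K = G ∩ GL₂(O_E)`: entries in `O_E` and determinant in `O_E^×`. -/
def Kset (S : USetting E) : Set (Mat E) :=
  {g | g ∈ Gset S ∧ (∀ i j, 0 ≤ S.nu (g i j)) ∧ S.nu g.det = 0}

/-- The congruence filtration subgroup `K_n` (for `n ≥ 1`; `K_0 = K` as a set). -/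
def Kfil (S : USetting E) (n : ℤ) : Set (Mat E) :=
  {g | g ∈ Kset S ∧ ∀ i j, (n : WithTop ℤ) ≤ S.nu ((g - 1) i j)}

/-- `𝓑 = B ∩ K`, the upper triangular matrices in `K`. -/
def Bcal (S : USetting E) : Set (Mat E) := {g | g ∈ Kset S ∧ g 1 0 = 0}

/-- `E^1`, the norm-one elements of `E`. -/
def E1set (S : USetting E) : Set E := {x | x * S.sig x = 1}

/-- `O_F^×` as a subset of `E`. -/
def OFunits (S : USetting E) : Set E := {x | S.sig x = x ∧ S.nu x = 0}

/-- `O_E^×` as a subset of `E`. -/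
def OEunits (S : USetting E) : Set E := {x | S.nu x = 0}

/-- A character of `E^×`, encoded as a function `E → ℂ` multiplicative and
nonvanishing on nonzero elements. -/
def IsChar (χ : E → ℂ) : Prop :=
  (∀ x y : E, x ≠ 0 → y ≠ 0 → χ (x * y) = χ x * χ y) ∧ ∀ x : E, x ≠ 0 → χ x ≠ 0

/-- A group homomorphism `E^1 → ℂ^×`, encoded as a function `E → ℂ`. -/
def IsE1Hom (S : USetting E) (φ : E → ℂ) : Prop :=
  (∀ x ∈ E1set S, ∀ y ∈ E1set S, φ (x * y) = φ x * φ y) ∧ ∀ x ∈ E1set S, φ x ≠ 0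

/-- A homomorphism into `ℂ^×` on a subset of matrices. -/
def IsHomOn (A : Set (Mat E)) (Ψ : Mat E → ℂ) : Prop :=
  (∀ x ∈ A, ∀ y ∈ A, Ψ (x * y) = Ψ x * Ψ y) ∧ ∀ x ∈ A, Ψ x ≠ 0

/-- `1 + p_E^n`. -/
def onePE (S : USetting E) (n : ℤ) : Set E := {x | (n : WithTop ℤ) ≤ S.nu (x - 1)}

/-- `1 + p_F^n`. -/
def onePF (S : USetting E) (n : ℤ) : Set E :=
  {x | S.sig x = x ∧ (n : WithTop ℤ) ≤ S.nu (x - 1)}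

/-- `χ` is trivial on a set. -/
def TrivOn (χ : E → ℂ) (s : Set E) : Prop := ∀ x ∈ s, χ x = 1

/-- `χ` has depth `r`: trivial on `1+p_E^{r+1}` and (if `r ≥ 1`) nontrivial on `1+p_E^r`. -/
def HasDepth (S : USetting E) (χ : E → ℂ) (r : ℕ) : Prop :=
  TrivOn χ (onePE S ((r : ℤ) + 1)) ∧ (r = 0 ∨ ¬ TrivOn χ (onePE S (r : ℤ)))

/-- `χ` has true depth `r`: the depth of its restriction to `F^×` is `r`. -/
def HasTrueDepth (S : USetting E) (χ : E → ℂ) (r : ℕ) : Prop :=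
  TrivOn χ (onePF S ((r : ℤ) + 1)) ∧ (r = 0 ∨ ¬ TrivOn χ (onePF S (r : ℤ)))

/-- `χ` has minimal depth `r`: its depth and true depth both equal `r`. -/
def MinDepth (S : USetting E) (χ : E → ℂ) (r : ℕ) : Prop :=
  HasDepth S χ r ∧ HasTrueDepth S χ r

/-- Right translation action on functions. -/
def rho (g : Mat E) : (Mat E → ℂ) →ₗ[ℂ] (Mat E → ℂ) where
  toFun f := fun k => f (k * g)
  map_add' _ _ := rfl
  map_smul' _ _ := rfl

/-- The space `V_χ^{K_n}`: functions on `K` (extended by zero off `K`) satisfying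
`f(bk) = χ(b₁₁) f(k)` for `b ∈ 𝓑` and right `K_n`-invariance. -/
def Vsp (S : USetting E) (χ : E → ℂ) (n : ℤ) : Submodule ℂ (Mat E → ℂ) where
  carrier := {f | (∀ x, x ∉ Kset S → f x = 0) ∧
    (∀ b ∈ Bcal S, ∀ k ∈ Kset S, f (b * k) = χ (b 0 0) * f k) ∧
    (∀ k ∈ Kset S, ∀ g ∈ Kfil S n, f (k * g) = f k)}
  add_mem' := by
    rintro f g ⟨hf0, hf1, hf2⟩ ⟨hg0, hg1, hg2⟩
    refine ⟨fun x hx => ?_, fun b hb k hk => ?_, fun k hk g' hg' => ?_⟩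
    · simp [hf0 x hx, hg0 x hx]
    · simp only [Pi.add_apply, hf1 b hb k hk, hg1 b hb k hk]; ring
    · simp only [Pi.add_apply, hf2 k hk g' hg', hg2 k hk g' hg']
  zero_mem' := by
    refine ⟨fun x _ => rfl, fun b _ k _ => by simp, fun k _ g _ => rfl⟩
  smul_mem' := by
    rintro c f ⟨hf0, hf1, hf2⟩
    refine ⟨fun x hx => ?_, fun b hb k hk => ?_, fun k hk g' hg' => ?_⟩
    · simp [hf0 x hx]
    · simp only [Pi.smul_apply, hf1 b hb k hk, smul_eq_mul]; ring
    · simp only [Pi.smul_apply, hf2 k hk g' hg']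

/-- The space of the representation induced from a character `Ψ` of a subgroup `H ⊆ K`:
functions on `K` (extended by zero) with `f(hk) = Ψ(h) f(k)`. -/
def IndSp (S : USetting E) (H : Set (Mat E)) (Ψ : Mat E → ℂ) : Submodule ℂ (Mat E → ℂ) where
  carrier := {f | (∀ x, x ∉ Kset S → f x = 0) ∧
    ∀ h ∈ H, ∀ k ∈ Kset S, f (h * k) = Ψ h * f k}
  add_mem' := by
    rintro f g ⟨hf0, hf1⟩ ⟨hg0, hg1⟩
    refine ⟨fun x hx => ?_, fun h hh k hk => ?_⟩
    · simp [hf0 x hx, hg0 x hx]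
    · simp only [Pi.add_apply, hf1 h hh k hk, hg1 h hh k hk]; ring
  zero_mem' := ⟨fun x _ => rfl, fun h _ k _ => by simp⟩
  smul_mem' := by
    rintro c f ⟨hf0, hf1⟩
    refine ⟨fun x hx => ?_, fun h hh k hk => ?_⟩
    · simp [hf0 x hx]
    · simp only [Pi.smul_apply, hf1 h hh k hk, smul_eq_mul]; ring

/-- The functions constant on `K` and zero off `K`. -/
def ConstSub (S : USetting E) : Submodule ℂ (Mat E → ℂ) where
  carrier := {f | (∀ x, x ∉ Kset S → f x = 0) ∧ ∃ c : ℂ, ∀ k ∈ Kset S, f k = c}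
  add_mem' := by
    rintro f g ⟨hf0, c, hc⟩ ⟨hg0, c', hc'⟩
    exact ⟨fun x hx => by simp [hf0 x hx, hg0 x hx],
      c + c', fun k hk => by simp [hc k hk, hc' k hk]⟩
  zero_mem' := ⟨fun x _ => rfl, 0, fun _ _ => rfl⟩
  smul_mem' := by
    rintro a f ⟨hf0, c, hc⟩
    exact ⟨fun x hx => by simp [hf0 x hx], a * c, fun k hk => by simp [hc k hk]⟩

/-- A subspace is `K`-invariant. -/
def KInvariant (S : USetting E) (W : Submodule ℂ (Mat E → ℂ)) : Prop :=
  ∀ g ∈ Kset S, ∀ f ∈ W, rho g f ∈ W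

/-- A subset `A ⊆ K` acts trivially on `W`. -/
def ActsTrivially (S : USetting E) (A : Set (Mat E)) (W : Submodule ℂ (Mat E → ℂ)) : Prop :=
  ∀ g ∈ A, ∀ f ∈ W, rho g f = f

/-- `W` is an irreducible representation of `K`. -/
def IsIrredRep (S : USetting E) (W : Submodule ℂ (Mat E → ℂ)) : Prop :=
  W ≠ ⊥ ∧ KInvariant S W ∧
    ∀ U : Submodule ℂ (Mat E → ℂ), U ≤ W → KInvariant S U → U = ⊥ ∨ U = W

/-- `V` and `W` are isomorphic as representations of `K`. -/
def RepIso (S : USetting E) (V W : Submodule ℂ (Mat E → ℂ)) : Prop :=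
  ∃ e : (Mat E → ℂ) →ₗ[ℂ] (Mat E → ℂ), Set.BijOn ⇑e ↑V ↑W ∧
    ∀ g ∈ Kset S, ∀ f ∈ V, e (rho g f) = rho g (e f)

/-- The space of `ℂ`-linear endomorphisms of `V` commuting with the right-translation
action of `K`, realized inside the function space `↥V → ↥V`. -/
def Commutant (S : USetting E) (V : Submodule ℂ (Mat E → ℂ)) :
    Submodule ℂ (↥V → ↥V) where
  carrier := {T | (∀ x y : ↥V, T (x + y) = T x + T y) ∧
    (∀ (c : ℂ) (x : ↥V), T (c • x) = c • T x) ∧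
    ∀ g ∈ Kset S, ∀ f : ↥V, ∀ h : rho g (f : Mat E → ℂ) ∈ V,
      ((T ⟨rho g (f : Mat E → ℂ), h⟩ : ↥V) : Mat E → ℂ) = rho g ((T f : ↥V) : Mat E → ℂ)}
  add_mem' := by
    rintro T T' ⟨hT1, hT2, hT3⟩ ⟨hT1', hT2', hT3'⟩
    refine ⟨fun x y => ?_, fun c x => ?_, fun g hg f h => ?_⟩
    · simp only [Pi.add_apply, hT1 x y, hT1' x y]; abel
    · simp only [Pi.add_apply, hT2 c x, hT2' c x, smul_add]
    · simp only [Pi.add_apply, Submodule.coe_add, hT3 g hg f h, hT3' g hg f h, map_add]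
  zero_mem' := by
    refine ⟨fun x y => by simp, fun c x => by simp, fun g hg f h => by simp⟩
  smul_mem' := by
    rintro c T ⟨hT1, hT2, hT3⟩
    refine ⟨fun x y => ?_, fun a x => ?_, fun g hg f h => ?_⟩
    · simp only [Pi.smul_apply, hT1 x y, smul_add]
    · simp only [Pi.smul_apply, hT2 a x, smul_comm c a]
    · simp only [Pi.smul_apply, Submodule.coe_smul, hT3 g hg f h, _root_.map_smul]

/-- The additive character `ψ` of `E`, `ψ(x) = ψ'((x + σ(x))/2)`. -/
def psiE (S : USetting E) (x : E) : ℂ := S.psi' ((x + S.sig x) / 2)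

/-- `Ψ_Y(g) = ψ(Tr(Y (g − 1)))`. -/
def PsiC (S : USetting E) (Y g : Mat E) : ℂ := psiE S ((Y * (g - 1)).trace)

/-- The Lie algebra `𝔤 = 𝔲(1,1)(F)`. -/
def gfrak (S : USetting E) : Set (Mat E) :=
  {Y | (Y.map ⇑S.sig)ᵀ * w0 E + w0 E * Y = 0}

/-- The lattice `𝔨_s` of the Lie algebra, where `c = ⌈s⌉`. -/
def kfrakC (S : USetting E) (c : ℤ) : Set (Mat E) :=
  {Y | Y ∈ gfrak S ∧ (c : WithTop ℤ) ≤ S.nu (Y 0 0) ∧ (c : WithTop ℤ) ≤ S.nu (Y 1 1) ∧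
    (∃ t, S.sig t = t ∧ (c : WithTop ℤ) ≤ S.nu t ∧ Y 0 1 = S.sqeps * t) ∧
    (∃ t, S.sig t = t ∧ (c : WithTop ℤ) ≤ S.nu t ∧ Y 1 0 = S.sqeps * t)}

/-- The group `J_d`. -/
def Jgrp (S : USetting E) (d : ℕ) : Set (Mat E) :=
  {g | g ∈ Kset S ∧ ((((d + 1) / 2 : ℕ) : WithTop ℤ) ≤ S.nu (g 0 0 - 1)) ∧
    ((((d + 1) / 2 : ℕ) : WithTop ℤ) ≤ S.nu (g 0 1)) ∧
    ((((d + 1) / 2 : ℕ) : WithTop ℤ) ≤ S.nu (g 1 1 - 1)) ∧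
    (((d / 2 + 1 : ℕ) : WithTop ℤ) ≤ S.nu (g 1 0))}

/-- The centralizer `T(X)` in `K` of `X = [[z√ε, u√ε],[v√ε, z√ε]]`. -/
def TXset (S : USetting E) (u v : E) : Set (Mat E) :=
  {m | m ∈ Kset S ∧ m 1 1 = m 0 0 ∧ m 1 0 = m 0 1 * (u⁻¹ * v)}

/-- The center `Z` of `G`, identified with scalar matrices with entries in `E^1`. -/
def Zset (S : USetting E) : Set (Mat E) := {m | ∃ z ∈ E1set S, m = z • (1 : Mat E)}

/-- `𝒰 = U ∩ K`. -/
def Uset (S : USetting E) : Set (Mat E) :=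
  {m | ∃ b, S.sig b = b ∧ 0 ≤ S.nu b ∧ m = !![1, b * S.sqeps; 0, 1]}

/-- The set of products `T(X)·J_d`. -/
def TXJ (S : USetting E) (u v : E) (d : ℕ) : Set (Mat E) :=
  {x | ∃ t ∈ TXset S u v, ∃ j ∈ Jgrp S d, x = t * j}

/-- The set of products `Z·𝒰·J_d`. -/
def ZUJ (S : USetting E) (d : ℕ) : Set (Mat E) :=
  {x | ∃ z ∈ Zset S, ∃ m ∈ Uset S, ∃ j ∈ Jgrp S d, x = z * m * j}

/-- `X = [[z√ε, u√ε],[v√ε, z√ε]]`. -/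
def Xzuv (S : USetting E) (z u v : E) : Mat E :=
  !![z * S.sqeps, u * S.sqeps; v * S.sqeps, z * S.sqeps]

/-- The nilpotent element `X_δ = [[0, δ√ε],[0,0]]`. -/
def Xdelta (S : USetting E) (δ : E) : Mat E := !![0, δ * S.sqeps; 0, 0]

/-- `W` is a `K`-invariant complement of `V_χ^{K_d}` inside `V_χ^{K_{d+1}}`. -/
def Wcompl (S : USetting E) (χ : E → ℂ) (d : ℕ) (W : Submodule ℂ (Mat E → ℂ)) : Prop :=
  W ≤ Vsp S χ ((d : ℤ) + 1) ∧ KInvariant S W ∧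
    Vsp S χ (d : ℤ) ⊓ W = ⊥ ∧ Vsp S χ (d : ℤ) ⊔ W = Vsp S χ ((d : ℤ) + 1)

namespace USetting

theorem nu_zero (S : USetting E) : S.nu 0 = ⊤ := (S.nu_eq_top 0).2 rfl

theorem nu_one (S : USetting E) : S.nu 1 = 0 := by
  have h := S.nu_mul 1 1
  have h0 : S.nu 1 ≠ ⊤ := fun h => one_ne_zero ((S.nu_eq_top 1).1 h)
  rw [one_mul] at h
  lift S.nu 1 to ℤ using h0 with n
  norm_cast at h ⊢
  lia

theorem nu_neg (S : USetting E) (x : E) : S.nu (-x) = S.nu x := by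
  have h := S.nu_mul (-1) (-1)
  have h0 : S.nu (-1) ≠ ⊤ := fun h => (neg_ne_zero.2 one_ne_zero) ((S.nu_eq_top (-1)).1 h)
  rw [neg_mul_neg, one_mul, S.nu_one] at h
  have h1 : S.nu (-1) = 0 := by
    lift S.nu (-1) to ℤ using h0 with n
    norm_cast at h ⊢
    lia
  rw [neg_eq_neg_one_mul, S.nu_mul, h1, zero_add]

theorem le_nu_add (S : USetting E) {x y : E} {c : WithTop ℤ} (hx : c ≤ S.nu x)
    (hy : c ≤ S.nu y) : c ≤ S.nu (x + y) :=
  (le_min hx hy).trans (S.nu_add x y)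

theorem le_nu_sub (S : USetting E) {x y : E} {c : WithTop ℤ} (hx : c ≤ S.nu x)
    (hy : c ≤ S.nu y) : c ≤ S.nu (x - y) := by
  rw [sub_eq_add_neg]
  exact S.le_nu_add hx (by rwa [S.nu_neg])

theorem le_nu_mul (S : USetting E) {x y : E} {a b : WithTop ℤ} (hx : a ≤ S.nu x)
    (hy : b ≤ S.nu y) : a + b ≤ S.nu (x * y) := by
  rw [S.nu_mul]
  exact add_le_add hx hy

theorem nu_inv_of_nu_eq_zero (S : USetting E) {x : E} (hx : S.nu x = 0) : S.nu x⁻¹ = 0 := by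
  have h0 : x ≠ 0 := by
    rintro rfl
    simp [S.nu_zero] at hx
  have h := S.nu_mul x x⁻¹
  rw [mul_inv_cancel₀ h0, S.nu_one, hx, zero_add] at h
  exact h.symm

theorem two_ne_zero (S : USetting E) : (2 : E) ≠ 0 := by
  intro h
  have := S.nu_two
  simp [h, S.nu_zero] at this

theorem sqeps_ne_zero (S : USetting E) : S.sqeps ≠ 0 := by
  intro h
  have := S.nu_sqeps
  simp [h, S.nu_zero] at this

theorem le_nu_half (S : USetting E) {x : E} {c : WithTop ℤ} (hx : c ≤ S.nu x) :
    c ≤ S.nu (x / 2) := by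
  rwa [div_eq_mul_inv, S.nu_mul, S.nu_inv_of_nu_eq_zero S.nu_two, add_zero]

theorem sig_half_trace (S : USetting E) (x : E) :
    S.sig ((x + S.sig x) / 2) = (x + S.sig x) / 2 := by
  rw [map_div₀, map_add, S.sig_invol, map_ofNat, add_comm]

/-- If `ψ'` is trivial on `F ∩ a·p_E^m`, then `ν(a) ≥ 1 - m`. -/
theorem le_nu_of_psi'_trivial (S : USetting E) {a : E} {m : ℤ}
    (h : ∀ x, S.sig x = x → (m : WithTop ℤ) ≤ S.nu (x / a) → a ≠ 0 → S.psi' x = 1) :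
    ((1 - m : ℤ) : WithTop ℤ) ≤ S.nu a := by
  by_contra hlt
  rw [not_le] at hlt
  have ha : a ≠ 0 := by
    rintro rfl
    simp [S.nu_zero] at hlt
  obtain ⟨x, hx, hx0, hx1⟩ := S.psi'_nontriv
  refine hx1 (h x hx ?_ ha)
  have hmul := S.nu_mul (x / a) a
  rw [div_mul_cancel₀ x ha] at hmul
  have hat : S.nu a ≠ ⊤ := fun h => ha ((S.nu_eq_top a).1 h)
  rw [hmul] at hx0
  lift S.nu a to ℤ using hat with n
  by_cases ht : S.nu (x / a) = ⊤
  · simp [ht]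
  lift S.nu (x / a) to ℤ using ht with r
  norm_cast at *
  lia

end USetting

section Psi

variable (S : USetting E)

theorem psiE_add (x y : E) : psiE S (x + y) = psiE S x * psiE S y := by
  unfold psiE
  rw [← S.psi'_mul _ _ (S.sig_half_trace x) (S.sig_half_trace y), map_add]
  congr 1
  ring

theorem psiE_ne_zero (x : E) : psiE S x ≠ 0 := S.psi'_ne _ (S.sig_half_trace x)

theorem psiE_eq_one {x : E} (hx : 1 ≤ S.nu x) : psiE S x = 1 :=
  S.psi'_triv _ (S.sig_half_trace x)
    (S.le_nu_half (S.le_nu_add hx (by rwa [S.nu_sig])))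

theorem psiE_of_fixed {x : E} (hx : S.sig x = x) : psiE S x = S.psi' x := by
  unfold psiE
  rw [hx, ← two_mul, mul_div_cancel_left₀ _ S.two_ne_zero]

theorem PsiC_add (Y Z g : Mat E) : PsiC S (Y + Z) g = PsiC S Y g * PsiC S Z g := by
  unfold PsiC
  rw [Matrix.add_mul, Matrix.trace_add, psiE_add]

theorem PsiC_conj (Y g k : Mat E) (hk : IsUnit k.det) :
    PsiC S Y (k⁻¹ * g * k) = PsiC S (k * Y * k⁻¹) g := by
  unfold PsiC
  have h : k⁻¹ * g * k - 1 = k⁻¹ * (g - 1) * k := by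
    rw [Matrix.mul_sub, Matrix.sub_mul, Matrix.mul_one, Matrix.nonsing_inv_mul k hk]
  rw [h, ← Matrix.mul_assoc, Matrix.trace_mul_comm, Matrix.mul_assoc, Matrix.mul_assoc]

end Psi

section Unitary

variable (S : USetting E)

theorem isUnit_det_of_mem_Kset {k : Mat E} (hk : k ∈ Kset S) : IsUnit k.det := by
  rw [isUnit_iff_ne_zero]
  intro h
  have := hk.2.2
  simp [h, S.nu_zero] at this

theorem map_sig_mul_transpose (A B : Mat E) :
    ((A * B).map S.sig)ᵀ = (B.map S.sig)ᵀ * (A.map S.sig)ᵀ := by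
  rw [Matrix.map_mul, Matrix.transpose_mul]

theorem mul_mem_Kset {g h : Mat E} (hg : g ∈ Kset S) (hh : h ∈ Kset S) : g * h ∈ Kset S := by
  refine ⟨?_, fun i j => ?_, ?_⟩
  · have h1 : (g.map S.sig)ᵀ * w0 E * g = w0 E := hg.1
    have h2 : (h.map S.sig)ᵀ * w0 E * h = w0 E := hh.1
    change ((g * h).map S.sig)ᵀ * w0 E * (g * h) = w0 E
    calc _ = (h.map S.sig)ᵀ * ((g.map S.sig)ᵀ * w0 E * g) * h := by
            rw [map_sig_mul_transpose]
            simp only [Matrix.mul_assoc]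
      _ = w0 E := by rw [h1, h2]
  · rw [Matrix.mul_apply, Fin.sum_univ_two]
    have := fun l => S.le_nu_mul (hg.2.1 i l) (hh.2.1 l j)
    simp only [add_zero] at this
    exact S.le_nu_add (this 0) (this 1)
  · rw [Matrix.det_mul, S.nu_mul, hg.2.2, hh.2.2, add_zero]

theorem sig_transpose_mul_w0 {k : Mat E} (hk : k ∈ Kset S) :
    (k.map S.sig)ᵀ * w0 E = w0 E * k⁻¹ := by
  have h1 : (k.map S.sig)ᵀ * w0 E * k = w0 E := hk.1
  have hu := isUnit_det_of_mem_Kset S hk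
  rw [← h1, Matrix.mul_assoc _ k, Matrix.mul_nonsing_inv k hu, Matrix.mul_one, h1]

theorem inv_sig_transpose_mul_w0 {k : Mat E} (hk : k ∈ Kset S) :
    (k⁻¹.map S.sig)ᵀ * w0 E = w0 E * k := by
  have hu := isUnit_det_of_mem_Kset S hk
  have h1 : (k.map S.sig)ᵀ * w0 E * k = w0 E := hk.1
  have h2 : (k⁻¹.map S.sig)ᵀ * (k.map S.sig)ᵀ = 1 := by
    rw [← map_sig_mul_transpose, Matrix.mul_nonsing_inv k hu, Matrix.map_one _ (map_zero _)
      (map_one _), Matrix.transpose_one]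
  calc (k⁻¹.map S.sig)ᵀ * w0 E = (k⁻¹.map S.sig)ᵀ * ((k.map S.sig)ᵀ * w0 E * k) := by rw [h1]
    _ = ((k⁻¹.map S.sig)ᵀ * (k.map S.sig)ᵀ) * w0 E * k := by simp only [Matrix.mul_assoc]
    _ = w0 E * k := by rw [h2, Matrix.one_mul]

theorem inv_mem_Kset {k : Mat E} (hk : k ∈ Kset S) : k⁻¹ ∈ Kset S := by
  have hu := isUnit_det_of_mem_Kset S hk
  have hd := S.nu_inv_of_nu_eq_zero hk.2.2
  refine ⟨?_, fun i j => ?_, ?_⟩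
  · change (k⁻¹.map S.sig)ᵀ * w0 E * k⁻¹ = w0 E
    rw [inv_sig_transpose_mul_w0 S hk, Matrix.mul_assoc, Matrix.mul_nonsing_inv k hu,
      Matrix.mul_one]
  · rw [Matrix.inv_def, Matrix.smul_apply, smul_eq_mul, Ring.inverse_eq_inv', S.nu_mul, hd,
      zero_add, Matrix.adjugate_fin_two]
    fin_cases i <;> fin_cases j <;> simp [S.nu_neg, hk.2.1]
  · rw [Matrix.det_nonsing_inv, Ring.inverse_eq_inv', hd]

theorem le_nu_conj {k Y : Mat E} (hk : k ∈ Kset S) {c : WithTop ℤ}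
    (hY : ∀ i j, c ≤ S.nu (Y i j)) (i j : Fin 2) : c ≤ S.nu ((k * Y * k⁻¹) i j) := by
  have h1 : ∀ i j, c ≤ S.nu ((k * Y) i j) := fun i j => by
    rw [Matrix.mul_apply, Fin.sum_univ_two]
    have := fun l => S.le_nu_mul (hk.2.1 i l) (hY l j)
    simp only [zero_add] at this
    exact S.le_nu_add (this 0) (this 1)
  rw [Matrix.mul_apply, Fin.sum_univ_two]
  have := fun l => S.le_nu_mul (h1 i l) ((inv_mem_Kset S hk).2.1 l j)
  simp only [add_zero] at this
  exact S.le_nu_add (this 0) (this 1)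

theorem conj_mem_Kfil {k g : Mat E} (hk : k ∈ Kset S) {n : ℤ} (hg : g ∈ Kfil S n) :
    k * g * k⁻¹ ∈ Kfil S n := by
  refine ⟨mul_mem_Kset S (mul_mem_Kset S hk hg.1) (inv_mem_Kset S hk), ?_⟩
  have h : k * g * k⁻¹ - 1 = k * (g - 1) * k⁻¹ := by
    rw [Matrix.mul_sub, Matrix.sub_mul, Matrix.mul_one,
      Matrix.mul_nonsing_inv k (isUnit_det_of_mem_Kset S hk)]
  rw [h]
  exact le_nu_conj S hk hg.2

theorem conj_mem_gfrak {k Y : Mat E} (hk : k ∈ Kset S) (hY : Y ∈ gfrak S) :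
    k * Y * k⁻¹ ∈ gfrak S := by
  have h : (Y.map S.sig)ᵀ * w0 E + w0 E * Y = 0 := hY
  change ((k * Y * k⁻¹).map S.sig)ᵀ * w0 E + w0 E * (k * Y * k⁻¹) = 0
  have h1 : w0 E * (k * Y * k⁻¹) = (k⁻¹.map S.sig)ᵀ * (w0 E * Y) * k⁻¹ := by
    rw [← Matrix.mul_assoc, ← Matrix.mul_assoc, ← Matrix.mul_assoc,
      inv_sig_transpose_mul_w0 S hk]
  have h2 : ((k * Y * k⁻¹).map S.sig)ᵀ * w0 E
      = (k⁻¹.map S.sig)ᵀ * ((Y.map S.sig)ᵀ * w0 E) * k⁻¹ := by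
    rw [map_sig_mul_transpose, map_sig_mul_transpose]
    simp only [Matrix.mul_assoc]
    rw [sig_transpose_mul_w0 S hk]
  rw [h1, h2, ← Matrix.add_mul, ← Matrix.mul_add, h, Matrix.mul_zero, Matrix.zero_mul]

theorem mem_gfrak_iff (Y : Mat E) : Y ∈ gfrak S ↔
    S.sig (Y 1 0) = -Y 1 0 ∧ S.sig (Y 0 1) = -Y 0 1 ∧ Y 1 1 = -S.sig (Y 0 0) := by
  change (Y.map S.sig)ᵀ * w0 E + w0 E * Y = 0 ↔ _
  rw [← Matrix.ext_iff]
  simp only [Fin.forall_fin_two, w0, Matrix.add_apply, Matrix.mul_apply, Fin.sum_univ_two,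
    Matrix.transpose_apply, Matrix.map_apply, Matrix.of_apply, Matrix.cons_val_zero,
    Matrix.cons_val_one, Matrix.zero_apply, Matrix.cons_val', Matrix.cons_val_fin_one,
    mul_zero, mul_one, zero_mul, one_mul, zero_add, add_zero]
  constructor
  · rintro ⟨⟨h1, h2⟩, h3, h4⟩
    exact ⟨eq_neg_of_add_eq_zero_left h1, eq_neg_of_add_eq_zero_left h4,
      eq_neg_of_add_eq_zero_right h2⟩
  · rintro ⟨h1, h2, h3⟩
    refine ⟨⟨by rw [h1]; ring, by rw [h3]; ring⟩, by rw [h3, map_neg, S.sig_invol]; ring,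
      by rw [h2]; ring⟩

theorem sub_mem_gfrak {Y Z : Mat E} (hY : Y ∈ gfrak S) (hZ : Z ∈ gfrak S) :
    Y - Z ∈ gfrak S := by
  rw [mem_gfrak_iff] at *
  obtain ⟨h1, h2, h3⟩ := hY
  obtain ⟨h4, h5, h6⟩ := hZ
  simp only [Matrix.sub_apply, map_sub, h1, h2, h3, h4, h5, h6]
  exact ⟨by ring, by ring, by ring⟩

/-- Membership in `𝔨_c` is a condition on valuations of the entries. -/
theorem mem_kfrakC_iff (Y : Mat E) (c : ℤ) :
    Y ∈ kfrakC S c ↔ Y ∈ gfrak S ∧ ∀ i j, (c : WithTop ℤ) ≤ S.nu (Y i j) := by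
  have he := S.sqeps_ne_zero
  have key : ∀ y, S.sig y = -y → (c : WithTop ℤ) ≤ S.nu y →
      ∃ t, S.sig t = t ∧ (c : WithTop ℤ) ≤ S.nu t ∧ y = S.sqeps * t := fun y hy hc =>
    ⟨y / S.sqeps, by rw [map_div₀, hy, S.sig_sqeps, neg_div_neg_eq],
      by rwa [div_eq_mul_inv, S.nu_mul, S.nu_inv_of_nu_eq_zero S.nu_sqeps, add_zero],
      (mul_div_cancel₀ y he).symm⟩
  constructor
  · rintro ⟨hY, h00, h11, ⟨t, -, ht, h01⟩, ⟨s, -, hs, h10⟩⟩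
    refine ⟨hY, ?_⟩
    simp only [Fin.forall_fin_two, h01, h10, S.nu_mul, S.nu_sqeps, zero_add]
    exact ⟨⟨h00, ht⟩, hs, h11⟩
  · rintro ⟨hY, h⟩
    have hY' := (mem_gfrak_iff S Y).1 hY
    exact ⟨hY, h 0 0, h 1 1, key _ hY'.2.1 (h 0 1), key _ hY'.1 (h 1 0)⟩

theorem mem_Kfil_of_entries {a b c e : E} {n : ℤ} (hn : 0 ≤ n)
    (hG : !![a, b; c, e] ∈ Gset S) (hdet : S.nu (a * e - b * c) = 0)
    (ha : (n : WithTop ℤ) ≤ S.nu (a - 1)) (hb : (n : WithTop ℤ) ≤ S.nu b)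
    (hc : (n : WithTop ℤ) ≤ S.nu c) (he : (n : WithTop ℤ) ≤ S.nu (e - 1)) :
    !![a, b; c, e] ∈ Kfil S n := by
  have hn' : (0 : WithTop ℤ) ≤ n := by exact_mod_cast hn
  have hunit : ∀ x, (n : WithTop ℤ) ≤ S.nu (x - 1) → 0 ≤ S.nu x := fun x hx => by
    rw [← sub_add_cancel x 1]
    exact S.le_nu_add (hn'.trans hx) S.nu_one.ge
  refine ⟨⟨hG, ?_, ?_⟩, ?_⟩
  · simp only [Fin.forall_fin_two]
    exact ⟨⟨hunit a ha, hn'.trans hb⟩, hn'.trans hc, hunit e he⟩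
  · rw [Matrix.det_fin_two_of, hdet]
  · simp only [Fin.forall_fin_two]
    simpa using ⟨⟨ha, hb⟩, hc, he⟩

theorem upper_mem_Kfil {b : E} {n : ℤ} (hn : 0 ≤ n) (hb : S.sig b = -b)
    (hnb : (n : WithTop ℤ) ≤ S.nu b) : !![1, b; 0, 1] ∈ Kfil S n := by
  refine mem_Kfil_of_entries S hn ?_ (by simp [S.nu_one]) (by simp [S.nu_zero]) hnb
    (by simp [S.nu_zero]) (by simp [S.nu_zero])
  change (Matrix.map _ S.sig)ᵀ * w0 E * _ = w0 E
  ext i j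
  fin_cases i <;> fin_cases j <;> simp [w0, Matrix.mul_apply, Fin.sum_univ_two, hb]

theorem lower_mem_Kfil {c : E} {n : ℤ} (hn : 0 ≤ n) (hc : S.sig c = -c)
    (hnc : (n : WithTop ℤ) ≤ S.nu c) : !![1, 0; c, 1] ∈ Kfil S n := by
  refine mem_Kfil_of_entries S hn ?_ (by simp [S.nu_one]) (by simp [S.nu_zero])
    (by simp [S.nu_zero]) hnc (by simp [S.nu_zero])
  change (Matrix.map _ S.sig)ᵀ * w0 E * _ = w0 E
  ext i j
  fin_cases i <;> fin_cases j <;> simp [w0, Matrix.mul_apply, Fin.sum_univ_two, hc]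

theorem nu_one_add {s : E} {n : ℤ} (hn : 0 < n) (hs : (n : WithTop ℤ) ≤ S.nu s) :
    S.nu (1 + s) = 0 := by
  have hn' : (1 : WithTop ℤ) ≤ S.nu s := le_trans (by exact_mod_cast hn) hs
  have h0 : (0 : WithTop ℤ) ≤ S.nu s := zero_le_one.trans hn'
  refine le_antisymm ?_ (S.le_nu_add S.nu_one.ge h0)
  by_contra h
  rw [not_le] at h
  have h1 : (1 : WithTop ℤ) ≤ S.nu (1 + s) := by
    by_cases ht : S.nu (1 + s) = ⊤
    · simp [ht]
    lift S.nu (1 + s) to ℤ using ht with r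
    norm_cast at *
  have h2 := S.le_nu_sub h1 hn'
  rw [add_sub_cancel_right, S.nu_one] at h2
  norm_cast at h2

theorem diag_mem_Kfil {s : E} {n : ℤ} (hn : 0 < n) (hs : (n : WithTop ℤ) ≤ S.nu s) :
    !![1 + s, 0; 0, (1 + S.sig s)⁻¹] ∈ Kfil S n := by
  have hs' : (n : WithTop ℤ) ≤ S.nu (S.sig s) := by rwa [S.nu_sig]
  have h1 := nu_one_add S hn hs
  have h2 := S.nu_inv_of_nu_eq_zero (nu_one_add S hn hs')
  have h0 : ∀ x, S.nu x = 0 → x ≠ 0 := by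
    rintro x hx rfl
    simp [S.nu_zero] at hx
  have h3 := h0 _ (nu_one_add S hn hs')
  have h4 := h0 _ h1
  refine mem_Kfil_of_entries S hn.le ?_ ?_ ?_ (by simp [S.nu_zero]) (by simp [S.nu_zero]) ?_
  · change (Matrix.map _ S.sig)ᵀ * w0 E * _ = w0 E
    ext i j
    fin_cases i <;> fin_cases j <;>
      simp [w0, Matrix.mul_apply, Fin.sum_univ_two, S.sig_invol, h3, h4]
  · rw [mul_zero, sub_zero, S.nu_mul, h1, h2, add_zero]
  · rwa [add_sub_cancel_left]
  · have : (1 + S.sig s)⁻¹ - 1 = -(S.sig s * (1 + S.sig s)⁻¹) := by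
      field_simp
      ring
    rw [this, S.nu_neg, S.nu_mul, h2, add_zero]
    exact hs'

/-- For `Y ∈ 𝔤` with entries of valuation at least `-d`, triviality of `Ψ_Y` on `K_m`
(with `2m > d`) is equivalent to `Y` having entries of valuation at least `1 - m`. -/
theorem PsiC_trivial_iff {Y : Mat E} (hY : Y ∈ gfrak S) {d m : ℤ} (hm : 0 < m)
    (hdm : d < 2 * m) (hYd : ((-d : ℤ) : WithTop ℤ) ≤ S.nu (Y 0 0)) :
    (∀ g ∈ Kfil S m, PsiC S Y g = 1) ↔ ∀ i j, ((1 - m : ℤ) : WithTop ℤ) ≤ S.nu (Y i j) := by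
  obtain ⟨h10, h01, h11⟩ := (mem_gfrak_iff S Y).1 hY
  constructor
  · intro h
    have a10 : ((1 - m : ℤ) : WithTop ℤ) ≤ S.nu (Y 1 0) := by
      refine S.le_nu_of_psi'_trivial fun x hx hn h0 => ?_
      have hg := h _ (upper_mem_Kfil S hm.le (by rw [map_div₀, hx, h10, div_neg]) hn)
      rw [PsiC, Matrix.trace_fin_two] at hg
      simpa [Matrix.mul_apply, Fin.sum_univ_two, mul_div_cancel₀, h0, psiE_of_fixed S hx] using hg
    have a01 : ((1 - m : ℤ) : WithTop ℤ) ≤ S.nu (Y 0 1) := by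
      refine S.le_nu_of_psi'_trivial fun x hx hn h0 => ?_
      have hg := h _ (lower_mem_Kfil S hm.le (by rw [map_div₀, hx, h01, div_neg]) hn)
      rw [PsiC, Matrix.trace_fin_two] at hg
      simpa [Matrix.mul_apply, Fin.sum_univ_two, mul_div_cancel₀, h0, psiE_of_fixed S hx] using hg
    have a00 : ((1 - m : ℤ) : WithTop ℤ) ≤ S.nu (Y 0 0) := by
      refine S.le_nu_of_psi'_trivial fun x hx hn h0 => ?_
      set s := x / Y 0 0 / 2 with hsdef
      have hs : (m : WithTop ℤ) ≤ S.nu s := S.le_nu_half hn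
      have hσs : (m : WithTop ℤ) ≤ S.nu (S.sig s) := by rwa [S.nu_sig]
      have hg := h _ (diag_mem_Kfil S hm hs)
      have hu := nu_one_add S hm hσs
      have hne : 1 + S.sig s ≠ 0 := by
        intro h
        simp [h, S.nu_zero] at hu
      have hYs : Y 0 0 * s = x / 2 := by
        rw [hsdef]
        field_simp
      have hYs' : S.sig (Y 0 0) * S.sig s = x / 2 := by
        rw [← map_mul, hYs, map_div₀, hx, map_ofNat]
      have htr : (Y * (!![1 + s, 0; 0, (1 + S.sig s)⁻¹] - 1)).trace
          = x - S.sig (Y 0 0) * (S.sig s * S.sig s) * (1 + S.sig s)⁻¹ := by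
        have h2 := S.two_ne_zero
        rw [Matrix.trace_fin_two]
        simp only [Matrix.mul_apply, Fin.sum_univ_two, Matrix.sub_apply, h11]
        simp only [Matrix.of_apply, Matrix.cons_val', Matrix.cons_val_zero, Matrix.cons_val_one,
          Matrix.cons_val_fin_one, Matrix.one_apply_eq, Matrix.one_fin_two, sub_zero, mul_zero,
          add_sub_cancel_left, add_zero, zero_add, hYs]
        have hxs : x = x / 2 + S.sig (Y 0 0) * S.sig s := by
          rw [hYs']
          field_simp
          ring
        conv_rhs => rw [hxs]
        field_simp
        ring
      have herr : (1 : WithTop ℤ) ≤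
          S.nu (-(S.sig (Y 0 0) * (S.sig s * S.sig s) * (1 + S.sig s)⁻¹)) := by
        have h1 := S.le_nu_mul (S.le_nu_mul (hYd.trans (S.nu_sig _).ge)
          (S.le_nu_mul hσs hσs)) (S.nu_inv_of_nu_eq_zero hu).ge
        rw [S.nu_neg]
        refine le_trans ?_ h1
        norm_cast
        lia
      rw [PsiC, htr, sub_eq_add_neg, psiE_add, psiE_eq_one S herr, mul_one,
        psiE_of_fixed S hx] at hg
      exact hg
    simp only [Fin.forall_fin_two]
    exact ⟨⟨a00, a01⟩, a10, by rwa [h11, S.nu_neg, S.nu_sig]⟩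
  · intro h g hg
    refine psiE_eq_one S ?_
    have key : ∀ i j, (1 : WithTop ℤ) ≤ S.nu (Y i j * (g - 1) j i) := fun i j => by
      refine le_trans ?_ (S.le_nu_mul (h i j) (hg.2 j i))
      norm_cast
      lia
    rw [Matrix.trace_fin_two, Matrix.mul_apply, Matrix.mul_apply, Fin.sum_univ_two,
      Fin.sum_univ_two]
    exact S.le_nu_add (S.le_nu_add (key 0 0) (key 0 1)) (S.le_nu_add (key 1 0) (key 1 1))

theorem Xzuv_mem_gfrak {z u v : E} (hz : S.sig z = z) (hu : S.sig u = u) (hv : S.sig v = v) :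
    Xzuv S z u v ∈ gfrak S := by
  rw [mem_gfrak_iff]
  simp [Xzuv, hz, hu, hv, S.sig_sqeps]

end Unitary

/-- for `X = [[z√ε, u√ε],[v√ε, z√ε]]` with `ν(z) ≥ −d`, `ν(v) > ν(u) = −d`,
and `k ∈ K`, conjugation by `k` fixes the character `Ψ_X` of `K_{⌊d/2⌋+1}` if and only if
`k X k⁻¹ − X ∈ 𝔨_{−d/2}`. -/
theorem stmt11 (S : USetting E) (d : ℕ) (hd : 0 < d) (z u v : E)
    (hz : S.sig z = z) (hu : S.sig u = u) (hv : S.sig v = v)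
    (hnz : ((-(d : ℤ) : ℤ) : WithTop ℤ) ≤ S.nu z)
    (hnu : S.nu u = ((-(d : ℤ) : ℤ) : WithTop ℤ))
    (hnv : ((-(d : ℤ) : ℤ) : WithTop ℤ) < S.nu v)
    (k : Mat E) (hk : k ∈ Kset S) :
    (∀ g ∈ Kfil S (((d / 2 : ℕ) : ℤ) + 1),
        PsiC S (Xzuv S z u v) (k * g * k⁻¹) = PsiC S (Xzuv S z u v) g) ↔
      k * Xzuv S z u v * k⁻¹ - Xzuv S z u v ∈ kfrakC S (-((d : ℤ) / 2)) := by
  set X := Xzuv S z u v with hX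
  have hdet := isUnit_det_of_mem_Kset S hk
  have hXg : X ∈ gfrak S := Xzuv_mem_gfrak S hz hu hv
  have hXd : ∀ i j, ((-(d : ℤ) : ℤ) : WithTop ℤ) ≤ S.nu (X i j) := by
    simp only [Fin.forall_fin_two]
    simp [hX, Xzuv, S.nu_mul, S.nu_sqeps] at hnz hnu hnv ⊢
    exact ⟨⟨hnz, hnu.ge⟩, hnv.le, hnz⟩
  have hYg := sub_mem_gfrak S (conj_mem_gfrak S hk hXg) hXg
  have hYd := S.le_nu_sub (le_nu_conj S hk hXd 0 0) (hXd 0 0)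
  rw [mem_kfrakC_iff, and_iff_right hYg]
  have hc : -((d : ℤ) / 2) = 1 - (((d / 2 : ℕ) : ℤ) + 1) := by
    push_cast
    ring
  rw [hc, ← PsiC_trivial_iff S hYg (by positivity) (by lia) hYd]
  have hsplit : ∀ g, PsiC S (k * X * k⁻¹) g = PsiC S (k * X * k⁻¹ - X) g * PsiC S X g :=
    fun g => by rw [← PsiC_add, sub_add_cancel]
  have hne : ∀ g, PsiC S X g ≠ 0 := fun g => psiE_ne_zero S _
  have hinv : k⁻¹⁻¹ = k := Matrix.nonsing_inv_nonsing_inv k hdet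
  constructor
  · intro h g hg
    have hg' := conj_mem_Kfil S (inv_mem_Kset S hk) hg
    rw [hinv] at hg'
    have h1 := h _ hg'
    have h2 : k * (k⁻¹ * g * k) * k⁻¹ = g := by
      simp only [Matrix.mul_assoc, Matrix.mul_nonsing_inv k hdet, Matrix.mul_one]
      rw [← Matrix.mul_assoc, Matrix.mul_nonsing_inv k hdet, Matrix.one_mul]
    rw [h2, PsiC_conj S X g k hdet, hsplit] at h1
    exact mul_right_cancel₀ (hne g) (by rw [one_mul]; exact h1.symm)
  · intro h g hg
    have h1 := hsplit (k * g * k⁻¹)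
    rw [h _ (conj_mem_Kfil S hk hg), one_mul, ← PsiC_conj S X _ k hdet] at h1
    have h2 : k⁻¹ * (k * g * k⁻¹) * k = g := by
      simp only [Matrix.mul_assoc, Matrix.nonsing_inv_mul k hdet, Matrix.mul_one]
      rw [← Matrix.mul_assoc, Matrix.nonsing_inv_mul k hdet, Matrix.one_mul]
    rw [← h1, h2]
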